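/- arXiv:1505.03072 — 3 statements merged into one kernel-verified Lean document; each statement's English description precedes it below -/
import Mathlib

section
/- Let n be a positive integer and let p = p_n satisfy n^{-2/3} < p < 1 - n^{-1/7}. Then every graph G on n vertices with exactly p·C(n,2) edges contains a full subgraph on at least (1/4)·(1-p)^{2/3}·n^{2/3} - 1 vertices; that is, f(n,p) ≥ (1/4)·(1-p)^{2/3}·n^{2/3} - 1. -/
open scoped Classical

/-- Number of neighbours of `v` inside `S`. -/
noncomputable def degIn {V : Type*} (G : SimpleGraph V) (S : Finset V) (v : V) : ℕ :=
  (S.filter fun u => G.Adj v u).card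

/-- `S` induces a full subgraph for density `p`: every vertex of `S` has
at least `p * (|S| - 1)` neighbours inside `S`. -/
def IsFull {V : Type*} (G : SimpleGraph V) (p : ℝ) (S : Finset V) : Prop :=
  ∀ v ∈ S, p * ((S.card : ℝ) - 1) ≤ (degIn G S v : ℝ)

/-! ### Sums of fractional parts along an arithmetic progression -/

/-- The fractional part of `y`, with values in `(0, 1]` instead of `[0, 1)`. -/
noncomputable def upperFract (y : ℝ) : ℝ := y - ⌈y⌉ + 1

lemma upperFract_pos (y : ℝ) : 0 < upperFract y := by
  have := Int.ceil_lt_add_one y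
  unfold upperFract; linarith

lemma upperFract_le_one (y : ℝ) : upperFract y ≤ 1 := by
  have := Int.le_ceil y
  unfold upperFract; linarith

lemma upperFract_add {p : ℝ} (hp0 : 0 < p) (hp1 : p < 1) (y : ℝ) :
    upperFract (y + p) = upperFract y + p ∨ upperFract (y + p) = upperFract y + p - 1 := by
  have h1 : ⌈y⌉ ≤ ⌈y + p⌉ := Int.ceil_le_ceil (by linarith)
  have h2 : ⌈y + p⌉ ≤ ⌈y⌉ + 1 := by
    rw [← Int.ceil_add_one]; exact Int.ceil_le_ceil (by linarith)
  rcases (show ⌈y + p⌉ = ⌈y⌉ ∨ ⌈y + p⌉ = ⌈y⌉ + 1 by omega) with h | h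
  · left; unfold upperFract; rw [h]; ring
  · right; unfold upperFract; rw [h]; push_cast; ring

lemma le_sum_upperFract {p : ℝ} (hp0 : 0 < p) (hp1 : p < 1) (a : ℝ) (L : ℕ) :
    L * (p * (1 - p)) - 1 / 4 ≤ 2 * p * ∑ j ∈ Finset.range L, upperFract (a + j * p) := by
  have key : L * (p * (1 - p)) + (upperFract (a + L * p) ^ 2 - upperFract (a + L * p))
      - (upperFract a ^ 2 - upperFract a)
      ≤ 2 * p * ∑ j ∈ Finset.range L, upperFract (a + j * p) := by
    induction L with
    | zero => simp
    | succ L ih =>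
      rw [Finset.sum_range_succ, mul_add]
      have e : a + ((L + 1 : ℕ) : ℝ) * p = a + L * p + p := by push_cast; ring
      have hpos := upperFract_pos (a + L * p + p)
      rw [e]
      push_cast
      rcases upperFract_add hp0 hp1 (a + L * p) with h | h <;> rw [h] at hpos ⊢ <;> nlinarith
  nlinarith [sq_nonneg (upperFract (a + L * p) - 1 / 2), upperFract_pos a, upperFract_le_one a]

lemma le_sum_upperFract' {p : ℝ} (hp0 : 0 < p) (hp1 : p < 1) (a : ℝ) (L : ℕ) :
    L * (p * (1 - p)) - 1 / 4
      ≤ 2 * (1 - p) * ∑ j ∈ Finset.range L, upperFract (a + j * p) := by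
  have key : L * (p * (1 - p)) + (upperFract (a - p) ^ 2 - upperFract (a - p))
      - (upperFract (a - p + L * p) ^ 2 - upperFract (a - p + L * p))
      ≤ 2 * (1 - p) * ∑ j ∈ Finset.range L, upperFract (a + j * p) := by
    induction L with
    | zero => simp
    | succ L ih =>
      rw [Finset.sum_range_succ, mul_add]
      have e : a - p + ((L + 1 : ℕ) : ℝ) * p = a - p + L * p + p := by push_cast; ring
      have e' : a + (L : ℝ) * p = a - p + L * p + p := by ring
      have hpos := upperFract_pos (a - p + L * p)
      rw [e, e']
      push_cast
      rcases upperFract_add hp0 hp1 (a - p + L * p) with h | h <;> rw [h] <;> nlinarith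
  nlinarith [sq_nonneg (upperFract (a - p) - 1 / 2), upperFract_pos (a - p + L * p),
    upperFract_le_one (a - p + L * p)]

/-- If `p` is not too close to `0` or `1`, then the average of `upperFract` over a long enough
arithmetic progression of difference `p` exceeds `1 / 8`. -/
lemma lt_sum_upperFract {p y : ℝ} (hy : 3 < y) (hy2 : 12 ≤ y ^ 2) (hp0 : 1 ≤ p * y ^ 2)
    (hp1 : 1 ≤ (1 - p) * y) (a : ℝ) (L : ℕ) (hL : 3 / 8 * y ^ 2 < L) :
    (L : ℝ) / 8 < ∑ j ∈ Finset.range L, upperFract (a + j * p) := by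
  have hp0' : 0 < p := by
    by_contra! h
    nlinarith
  have hp1' : p < 1 := by
    by_contra! h
    nlinarith
  rcases le_total p (1 / 2) with h | h
  · have key := le_sum_upperFract hp0' hp1' a L
    have h1 : 1 < L * (p * (3 - 4 * p)) := by
      have h2 : 8 / 3 ≤ y ^ 2 * (p * (3 - 4 * p)) := by
        rcases le_total p (1 / 12) with h' | h'
        · nlinarith
        · have : 2 / 9 ≤ p * (3 - 4 * p) := by nlinarith
          nlinarith
      have h3 : 0 < p * (3 - 4 * p) := mul_pos hp0' (by linarith)
      nlinarith
    have : 2 * p * ((L : ℝ) / 8) < 2 * p * ∑ j ∈ Finset.range L, upperFract (a + j * p) := by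
      nlinarith
    exact lt_of_mul_lt_mul_left this (by linarith)
  · have key := le_sum_upperFract' hp0' hp1' a L
    have h1 : 1 < L * (1 - p) := by
      have h2 : y < L := by nlinarith
      nlinarith
    have : 2 * (1 - p) * ((L : ℝ) / 8)
        < 2 * (1 - p) * ∑ j ∈ Finset.range L, upperFract (a + j * p) := by
      nlinarith
    exact lt_of_mul_lt_mul_left this (by linarith)

/-! ### Edges inside a set -/

section Edges

variable {V : Type*} [DecidableEq V] (G : SimpleGraph V)

/-- The number of edges of `G` inside `S`. -/
noncomputable def edgesIn {V : Type*} (G : SimpleGraph V) (S : Finset V) : ℝ :=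
  (∑ v ∈ S, (degIn G S v : ℝ)) / 2

lemma degIn_insert {S : Finset V} {u : V} (hu : u ∉ S) (v : V) :
    degIn G (insert u S) v = degIn G S v + if G.Adj v u then 1 else 0 := by
  unfold degIn
  rw [Finset.filter_insert]
  split_ifs with h
  · rw [Finset.card_insert_of_notMem (by simp [hu])]
  · rfl

lemma degIn_insert_self {S : Finset V} {v : V} (hv : v ∉ S) :
    degIn G (insert v S) v = degIn G S v := by
  simp [degIn_insert G hv]

lemma degIn_erase_self {S : Finset V} {v : V} (hv : v ∈ S) :
    degIn G (S.erase v) v = degIn G S v := by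
  rw [← degIn_insert_self G (Finset.notMem_erase v S), Finset.insert_erase hv]

lemma edgesIn_insert {S : Finset V} {v : V} (hv : v ∉ S) :
    edgesIn G (insert v S) = edgesIn G S + degIn G S v := by
  unfold edgesIn
  rw [Finset.sum_insert hv, degIn_insert_self G hv]
  have h : ∑ w ∈ S, (degIn G (insert v S) w : ℝ)
      = ∑ w ∈ S, (degIn G S w : ℝ) + degIn G S v := by
    have h1 : (degIn G S v : ℝ) = ∑ w ∈ S, if G.Adj w v then (1 : ℝ) else 0 := by
      rw [Finset.sum_boole]
      unfold degIn
      simp only [G.adj_comm v]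
    rw [h1, ← Finset.sum_add_distrib]
    refine Finset.sum_congr rfl fun w _ => ?_
    rw [degIn_insert G hv]
    push_cast
    rfl
  rw [h]
  ring

lemma edgesIn_erase {S : Finset V} {v : V} (hv : v ∈ S) :
    edgesIn G S = edgesIn G (S.erase v) + degIn G S v := by
  have h := edgesIn_insert G (Finset.notMem_erase v S)
  rwa [Finset.insert_erase hv, degIn_erase_self G hv] at h

lemma card_eq_card_erase_add_one {S : Finset V} {v : V} (hv : v ∈ S) :
    (S.card : ℝ) = (S.erase v).card + 1 := by
  exact_mod_cast (Finset.card_erase_add_one hv).symm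

lemma degIn_le {S : Finset V} {v : V} (hv : v ∈ S) : (degIn G S v : ℝ) ≤ S.card - 1 := by
  rw [← degIn_erase_self G hv, card_eq_card_erase_add_one hv, add_sub_cancel_right]
  exact_mod_cast Finset.card_filter_le _ _

lemma edgesIn_le (S : Finset V) : edgesIn G S ≤ S.card * (S.card - 1) / 2 := by
  have h : ∑ v ∈ S, (degIn G S v : ℝ) ≤ ∑ _v ∈ S, ((S.card : ℝ) - 1) :=
    Finset.sum_le_sum fun v hv => degIn_le G hv
  rw [Finset.sum_const, nsmul_eq_mul] at h
  unfold edgesIn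
  linarith

/-- The number of edges inside `S` in excess of those expected at density `p`. -/
noncomputable def excess {V : Type*} (G : SimpleGraph V) (p : ℝ) (S : Finset V) : ℝ :=
  edgesIn G S - p * (S.card * (S.card - 1) / 2)

lemma le_degIn_of_forall_excess_le {p δ : ℝ} {S : Finset V}
    (h : ∀ T, excess G p T + δ * T.card ≤ excess G p S + δ * S.card) {v : V} (hv : v ∈ S) :
    p * (S.card - 1) - δ ≤ degIn G S v := by
  have h1 := h (S.erase v)
  unfold excess at h1
  rw [edgesIn_erase G hv, card_eq_card_erase_add_one hv] at h1
  rw [card_eq_card_erase_add_one hv]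
  linarith

variable [Fintype V]

lemma excess_le_of_forall_isFull {p B : ℝ} (hp : 0 ≤ p)
    (hB : ∀ S : Finset V, IsFull G p S → (S.card : ℝ) < B) (hB1 : 1 ≤ B) (S : Finset V) :
    excess G p S ≤ B * (B - 1) / 2 := by
  obtain ⟨T, hT⟩ := Finite.exists_max fun T : Finset V => excess G p T
  have hfull : IsFull G p T := fun v hv => by
    have := le_degIn_of_forall_excess_le G (δ := 0) (by simpa using hT) hv
    simpa using this
  have h1 := hB T hfull
  have h2 := edgesIn_le G T
  have h3 : excess G p T ≤ B * (B - 1) / 2 := by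
    rcases Nat.eq_zero_or_pos T.card with h0 | h0
    · unfold excess
      rw [h0] at h2 ⊢
      norm_num at h2 ⊢
      nlinarith
    · have h0' : (1 : ℝ) ≤ T.card := by exact_mod_cast h0
      have : 0 ≤ p * ((T.card : ℝ) * (T.card - 1) / 2) :=
        mul_nonneg hp (by nlinarith)
      unfold excess
      nlinarith
  exact (hT S).trans h3

/-- If all full sets have less than `B` vertices and `G` has density at least `p`, then deleting
few vertices leaves a set in which all degrees are almost as large as in a full set. -/
lemma exists_almost_full {p B δ : ℝ} (hp : 0 ≤ p)
    (hB : ∀ S : Finset V, IsFull G p S → (S.card : ℝ) < B) (hB1 : 1 ≤ B)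
    (hG : 0 ≤ excess G p Finset.univ) :
    ∃ U : Finset V, (∀ v ∈ U, p * (U.card - 1) - δ ≤ degIn G U v) ∧
      δ * (Fintype.card V - U.card) ≤ B * (B - 1) / 2 := by
  obtain ⟨U, hU⟩ := Finite.exists_max fun T : Finset V => excess G p T + δ * T.card
  refine ⟨U, fun v hv => le_degIn_of_forall_excess_le G hU hv, ?_⟩
  have h1 := hU Finset.univ
  have h2 := excess_le_of_forall_isFull G hp hB hB1 U
  simp only [Finset.card_univ] at h1
  linarith

end Edges

/-! ### Optimal partitions -/

lemma add_le_add_of_sum_le_sum {ι : Type*} [Fintype ι] [DecidableEq ι] {a b : ι → ℝ} {i j : ι}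
    (hij : i ≠ j) (h : ∀ k, k ≠ i → k ≠ j → a k = b k) (hs : ∑ k, a k ≤ ∑ k, b k) :
    a i + a j ≤ b i + b j := by
  have hj : j ∈ Finset.univ.erase i := by simp [hij.symm]
  rw [← Finset.add_sum_erase _ a (Finset.mem_univ i), ← Finset.add_sum_erase _ a hj,
    ← Finset.add_sum_erase _ b (Finset.mem_univ i), ← Finset.add_sum_erase _ b hj] at hs
  have : ∑ k ∈ (Finset.univ.erase i).erase j, a k = ∑ k ∈ (Finset.univ.erase i).erase j, b k := by
    refine Finset.sum_congr rfl fun k hk => ?_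
    simp only [Finset.mem_erase] at hk
    exact h k hk.2.1 hk.1
  linarith

section Partition

variable {V : Type*} [DecidableEq V] [Fintype V] (G : SimpleGraph V)

/-- The cost of a part of size `m`: the distinguished part `none` is charged
`⌈p * t⌉ - 7 / 8` for its vertex number `t`, the other parts are charged `p * t`. -/
noncomputable def partCost {R : ℕ} (p : ℝ) : Option (Fin R) → ℕ → ℝ
  | none, m => ∑ t ∈ Finset.range m, ((⌈(t : ℝ) * p⌉ : ℝ) - 7 / 8)
  | some _, m => ∑ t ∈ Finset.range m, (t : ℝ) * p

/-- A set all of whose degrees are at most `R / 8` short of fullness splits into a full set `A` and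
`R` other sets none of which is much larger than `A`. -/
lemma exists_isFull_of_almost_full {p y : ℝ} (hy : 3 < y) (hy2 : 12 ≤ y ^ 2)
    (hp0 : 1 ≤ p * y ^ 2) (hp1 : 1 ≤ (1 - p) * y) (R : ℕ) (U : Finset V)
    (hU : ∀ v ∈ U, p * (U.card - 1) - R / 8 ≤ degIn G U v) :
    ∃ A : Finset V, IsFull G p A ∧
      (U.card : ℝ) ≤ A.card + R * (A.card + 3 / 8 * y ^ 2) := by
  let P : (V → Option (Fin R)) → Option (Fin R) → Finset V := fun c i => U.filter fun v => c v = i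
  obtain ⟨c, hc⟩ := Finite.exists_max fun c : V → Option (Fin R) =>
    ∑ i, (edgesIn G (P c i) - partCost p i (P c i).card)
  have hcard : (U.card : ℝ) = (P c none).card + ∑ j, ((P c (some j)).card : ℝ) := by
    rw [← Fintype.sum_option fun i => ((P c i).card : ℝ)]
    exact_mod_cast Finset.card_eq_sum_card_fiberwise (f := c) (t := Finset.univ) (by simp)
  refine ⟨P c none, fun v hv => ?_, ?_⟩
  · have hvU : v ∈ U := (Finset.mem_filter.1 hv).1
    have hcv : c v = none := (Finset.mem_filter.1 hv).2
    have hdeg : (degIn G U v : ℝ)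
        = degIn G (P c none) v + ∑ j, (degIn G (P c (some j)) v : ℝ) := by
      rw [← Fintype.sum_option fun i => (degIn G (P c i) v : ℝ)]
      unfold degIn
      rw [Finset.card_eq_sum_card_fiberwise (f := c) (t := Finset.univ) (by simp)]
      push_cast
      refine Finset.sum_congr rfl fun i _ => ?_
      rw [Finset.filter_filter, Finset.filter_filter]
      simp only [and_comm]
    have hmove : ∀ j : Fin R, (degIn G (P c (some j)) v : ℝ) - (P c (some j)).card * p
        ≤ degIn G (P c none) v - (⌈(((P c none).card : ℝ) - 1) * p⌉ - 7 / 8) := by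
      intro j
      have h0 : P (Function.update c v (some j)) none = (P c none).erase v := by
        ext w
        by_cases hw : w = v <;> simp [P, hw]
      have hj : P (Function.update c v (some j)) (some j) = insert v (P c (some j)) := by
        ext w
        by_cases hw : w = v <;> simp [P, hw, hvU]
      have hvj : v ∉ P c (some j) := by simp [P, hcv]
      have h := add_le_add_of_sum_le_sum (i := none) (j := some j) (by simp) ?_
        (hc (Function.update c v (some j)))
      · rw [h0, hj, edgesIn_insert G hvj, edgesIn_erase G hv, Finset.card_insert_of_notMem hvj,
          ← Finset.card_erase_add_one hv] at h
        rw [card_eq_card_erase_add_one hv]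
        simp only [partCost, Finset.sum_range_succ, add_sub_cancel_right] at h ⊢
        linarith
      · intro k hk0 hkj
        have : P (Function.update c v (some j)) k = P c k := by
          ext w
          by_cases hw : w = v
          · simp [P, hw, hcv, hk0.symm, hkj.symm]
          · simp [P, hw]
        simp only [this]
    by_contra! hlt
    have hsum := Finset.sum_le_sum fun j (_ : j ∈ Finset.univ) => hmove j
    rw [Finset.sum_sub_distrib, Finset.sum_const, Finset.card_univ, Fintype.card_fin,
      nsmul_eq_mul, ← Finset.sum_mul] at hsum
    have hint : (degIn G (P c none) v : ℝ) + 1 ≤ ⌈(((P c none).card : ℝ) - 1) * p⌉ := by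
      have : ((degIn G (P c none) v : ℤ) : ℝ) < (((P c none).card : ℝ) - 1) * p := by
        push_cast; linarith
      exact_mod_cast Int.add_one_le_iff.2 (Int.lt_ceil.2 this)
    have hUv := hU v hvU
    have hR : (0 : ℝ) ≤ R := Nat.cast_nonneg R
    have := mul_le_mul_of_nonneg_left hint hR
    rw [hdeg, hcard] at hUv
    linarith
  · have hsize : ∀ j : Fin R, ((P c (some j)).card : ℝ) ≤ (P c none).card + 3 / 8 * y ^ 2 := by
      intro j
      by_contra! hlt
      let c' : V → Option (Fin R) := fun v => Equiv.swap none (some j) (c v)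
      have hP : ∀ k, P c' k = P c (Equiv.swap none (some j) k) := fun k => by
        ext w
        simp only [P, c', Finset.mem_filter]
        exact and_congr_right fun _ => Equiv.swap_apply_eq_iff
      have h := add_le_add_of_sum_le_sum (i := none) (j := some j) (by simp)
        (fun k hk0 hkj => by rw [hP, Equiv.swap_apply_of_ne_of_ne hk0 hkj]) (hc c')
      rw [hP, hP, Equiv.swap_apply_left, Equiv.swap_apply_right] at h
      have hle : (P c none).card ≤ (P c (some j)).card := by
        have : ((P c none).card : ℝ) ≤ (P c (some j)).card := by nlinarith
        exact_mod_cast this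
      obtain ⟨L, hL⟩ := Nat.exists_eq_add_of_le hle
      rw [hL] at hlt h
      push_cast at hlt
      have hlong := lt_sum_upperFract hy hy2 hp0 hp1 ((P c none).card * p) L (by linarith)
      simp only [partCost, Finset.sum_range_add] at h
      have hterm : ∑ t ∈ Finset.range L, ((⌈(((P c none).card + t : ℕ) : ℝ) * p⌉ : ℝ) - 7 / 8)
          = ∑ t ∈ Finset.range L, (((P c none).card + t : ℕ) : ℝ) * p
            - ∑ t ∈ Finset.range L, upperFract ((P c none).card * p + t * p) + L / 8 := by
        rw [← Finset.sum_sub_distrib, Finset.sum_congr rfl (g := fun t : ℕ =>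
          (((((P c none).card + t : ℕ) : ℝ) * p
            - upperFract ((P c none).card * p + t * p)) + 1 / 8)), Finset.sum_add_distrib]
        · simp; ring
        · intro t _
          have e : (((P c none).card + t : ℕ) : ℝ) * p = (P c none).card * p + t * p := by
            push_cast; ring
          rw [e, upperFract]
          ring
      linarith
    have hsum := Finset.sum_le_sum fun j (_ : j ∈ Finset.univ) => hsize j
    rw [Finset.sum_const, Finset.card_univ, Fintype.card_fin, nsmul_eq_mul] at hsum
    linarith

/-- A graph of density at least `p` has a full set of size at least `y ^ 2 / 4 - 1`, where
`y ^ 3` is the number of vertices. -/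
lemma exists_isFull_of_excess_nonneg {p y : ℝ} (hy : 3 < y) (hy2 : 12 ≤ y ^ 2)
    (hp0 : 1 ≤ p * y ^ 2) (hp1 : 1 ≤ (1 - p) * y) (hV : (Fintype.card V : ℝ) = y ^ 3)
    (hG : 0 ≤ excess G p Finset.univ) :
    ∃ S : Finset V, IsFull G p S ∧ y ^ 2 / 4 - 1 ≤ S.card := by
  by_contra! hno
  have hp : 0 ≤ p := by
    by_contra! h
    nlinarith
  set R : ℕ := ⌈y / 2⌉₊ with hR
  have hR1 : y / 2 ≤ R := Nat.le_ceil _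
  have hR2 : R < y / 2 + 1 := Nat.ceil_lt_add_one (by linarith)
  obtain ⟨U, hU, hUcard⟩ := exists_almost_full G (δ := R / 8) hp hno (by linarith) hG
  obtain ⟨A, hA, hAcard⟩ := exists_isFull_of_almost_full G hy hy2 hp0 hp1 R U hU
  have hAlt := hno A hA
  rw [hV] at hUcard
  have hUlt : (U.card : ℝ) ≤ y ^ 2 / 4 + R * (5 / 8 * y ^ 2) := by
    have : (R : ℝ) * (A.card + 3 / 8 * y ^ 2) ≤ R * (5 / 8 * y ^ 2) :=
      mul_le_mul_of_nonneg_left (by linarith) (by linarith)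
    linarith
  have h1 : R * y ^ 3 ≤ R * (y ^ 2 / 4 + R * (5 / 8 * y ^ 2)) + y ^ 4 / 4 := by
    have := mul_le_mul_of_nonneg_left hUlt (show (0 : ℝ) ≤ R by linarith)
    nlinarith
  have h2 : R * y ≤ R * (1 / 4 + R * (5 / 8)) + y ^ 2 / 4 := by
    have : y ^ 2 * (R * y) ≤ y ^ 2 * (R * (1 / 4 + R * (5 / 8)) + y ^ 2 / 4) := by linarith
    exact le_of_mul_le_mul_left this (by positivity)
  have h3 : ((R : ℝ) - y / 2) * (R - y / 2 - 1) ≤ 0 :=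
    mul_nonpos_of_nonneg_of_nonpos (by linarith) (by linarith)
  nlinarith

end Partition

lemma excess_univ_eq_zero {n : ℕ} (G : SimpleGraph (Fin n)) {p : ℝ}
    (hG : (G.edgeFinset.card : ℝ) = p * (n.choose 2 : ℕ)) : excess G p Finset.univ = 0 := by
  have h1 : ∑ v, (degIn G Finset.univ v : ℝ) = 2 * G.edgeFinset.card := by
    have := G.sum_degrees_eq_twice_card_edges
    have h2 : ∀ v, degIn G Finset.univ v = G.degree v := fun v => by
      rw [← SimpleGraph.card_neighborFinset_eq_degree, SimpleGraph.neighborFinset_eq_filter]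
      rfl
    simp only [h2]
    exact_mod_cast this
  unfold excess edgesIn
  rw [h1, hG, Finset.card_univ, Fintype.card_fin, Nat.cast_choose_two]
  ring

lemma isFull_pair {V : Type*} [DecidableEq V] {G : SimpleGraph V} {p : ℝ} (hp : p ≤ 1) {u v : V}
    (h : G.Adj u v) : IsFull G p {u, v} := by
  have hne := h.ne
  intro w hw
  rw [Finset.card_pair hne]
  have h1 : 1 ≤ degIn G {u, v} w := by
    refine Finset.card_pos.2 ?_
    rcases Finset.mem_insert.1 hw with rfl | hw
    · exact ⟨v, by simp [h]⟩
    · rw [Finset.mem_singleton.1 hw]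
      exact ⟨u, by simp [h.symm]⟩
  have h2 : (1 : ℝ) ≤ degIn G {u, v} w := by exact_mod_cast h1
  push_cast
  linarith

/-- for `n⁻²ᐟ³ < p < 1 - n⁻¹ᐟ⁷`, every `n`-vertex graph with exactly
`p * C(n,2)` edges has a full subgraph on at least `(1/4)(1-p)^(2/3) n^(2/3) - 1` vertices. -/
theorem stmt0 (n : ℕ) (hn : 0 < n) (p : ℝ)
    (hp1 : (n : ℝ) ^ (-(2/3 : ℝ)) < p) (hp2 : p < 1 - (n : ℝ) ^ (-(1/7 : ℝ)))
    (G : SimpleGraph (Fin n))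
    (hG : (G.edgeFinset.card : ℝ) = p * (n.choose 2 : ℕ)) :
    ∃ S : Finset (Fin n), IsFull G p S ∧
      (1/4 : ℝ) * (1 - p) ^ ((2 : ℝ)/3) * (n : ℝ) ^ ((2 : ℝ)/3) - 1 ≤ (S.card : ℝ) := by
  have hn1 : (1 : ℝ) ≤ n := by exact_mod_cast hn
  have hn0 : (0 : ℝ) ≤ n := by linarith
  have hnpos : (0 : ℝ) < n := by linarith
  have hp0 : 0 < p := (Real.rpow_pos_of_pos hnpos _).trans hp1
  have hp1' : p < 1 := by linarith [Real.rpow_pos_of_pos hnpos (-(1/7 : ℝ))]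
  set y : ℝ := (n : ℝ) ^ (1 / 3 : ℝ) with hy
  have hypos : 0 < y := Real.rpow_pos_of_pos hnpos _
  have hy2 : (n : ℝ) ^ ((2 : ℝ) / 3) = y ^ 2 := by
    rw [hy, ← Real.rpow_natCast, ← Real.rpow_mul hn0]; norm_num
  have hy3 : (n : ℝ) = y ^ 3 := by
    rw [hy, ← Real.rpow_natCast, ← Real.rpow_mul hn0]; norm_num
  have hbound : (1/4 : ℝ) * (1 - p) ^ ((2 : ℝ)/3) * (n : ℝ) ^ ((2 : ℝ)/3) - 1
      ≤ y ^ 2 / 4 - 1 := by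
    have : (1 - p) ^ ((2 : ℝ)/3) ≤ 1 :=
      Real.rpow_le_one (by linarith) (by linarith) (by norm_num)
    rw [hy2]
    nlinarith [sq_nonneg y]
  rcases le_total (y ^ 2) 12 with hsmall | hlarge
  · have hn2 : 2 ≤ n := by
      by_contra! h
      have : n = 1 := by omega
      subst this
      simp at hp2
      linarith
    have hE : 0 < G.edgeFinset.card := by
      have h : (0 : ℝ) < G.edgeFinset.card := by
        rw [hG]
        exact mul_pos hp0 (by exact_mod_cast Nat.choose_pos hn2)
      exact_mod_cast h
    obtain ⟨e, he⟩ := Finset.card_pos.1 hE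
    induction e with
    | _ u v =>
      have huv : G.Adj u v := by simpa using he
      refine ⟨{u, v}, isFull_pair hp1'.le huv, ?_⟩
      rw [Finset.card_pair huv.ne]
      push_cast
      linarith
  · have hy' : 3 < y := by nlinarith
    have h1 : 1 ≤ p * y ^ 2 := by
      rw [Real.rpow_neg hn0, hy2] at hp1
      have := mul_le_mul_of_nonneg_right hp1.le (sq_nonneg y)
      rwa [inv_mul_cancel₀ (by positivity)] at this
    have h2 : 1 ≤ (1 - p) * y := by
      have h3 : (n : ℝ) ^ (-(1/3 : ℝ)) ≤ (n : ℝ) ^ (-(1/7 : ℝ)) :=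
        Real.rpow_le_rpow_of_exponent_le hn1 (by norm_num)
      rw [Real.rpow_neg hn0, ← hy] at h3
      have := mul_le_mul_of_nonneg_right (show y⁻¹ ≤ 1 - p by linarith) hypos.le
      rwa [inv_mul_cancel₀ hypos.ne'] at this
    obtain ⟨S, hS, hcard⟩ := exists_isFull_of_excess_nonneg G hy' hlarge h1 h2
      (by rw [Fintype.card_fin]; exact hy3) (excess_univ_eq_zero G hG).ge
    exact ⟨S, hS, hbound.trans hcard⟩
end

section
/- For each integer r ≥ 1 and each real c ≥ 1 there exists a constant C > 0 such that for all sufficiently large n for which p = r/(r+1) + c·((r+1)n)^{-2/3} satisfies p·C((r+1)n, 2) ∈ ℕ, there exists a graph G on (r+1)n vertices with exactly p·C((r+1)n,2) edges such that every full subgraph of G has at most C·((r+1)n)^{2/3} vertices. -/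
open scoped Classical

/-- If the edges of `G` inside the classes of an `(r + 1)`-colouring all lie in a set `K`, then
the full subgraphs of density `r / (r + 1) + ε` are small. -/
theorem IsFull.card_le {V : Type*} {G : SimpleGraph V} {r : ℕ} {ε : ℝ} (hε : 0 < ε) (χ : V → ℕ)
    (hχ : ∀ v, χ v < r + 1) {K : Finset V} (hK : ∀ u v, G.Adj u v → χ u = χ v → u ∈ K)
    {S : Finset V} (hS : IsFull G ((r : ℝ) / (r + 1) + ε) S) :
    (S.card : ℝ) ≤ (r + 1) * K.card + 1 + 1 / ε := by
  have hr : (0 : ℝ) < r + 1 := by positivity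
  have hε' : 0 < 1 / ε := by positivity
  rcases S.eq_empty_or_nonempty with rfl | hne
  · simp only [Finset.card_empty, Nat.cast_zero]
    positivity
  obtain ⟨i, -, hi⟩ := Finset.exists_le_card_fiber_of_nsmul_le_card_of_maps_to
    (s := S) (t := Finset.range (r + 1)) (f := χ) (b := (S.card : ℝ) / (r + 1))
    (fun v _ => Finset.mem_range.2 (hχ v)) (by simp) (by
      rw [Finset.card_range, nsmul_eq_mul]
      push_cast
      rw [mul_div_cancel₀ _ hr.ne'])
  by_cases hsub : S.filter (fun v => χ v = i) ⊆ K
  · have hle : ((S.filter fun v => χ v = i).card : ℝ) ≤ K.card := by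
      exact_mod_cast Finset.card_le_card hsub
    have h := hi.trans hle
    rw [div_le_iff₀ hr] at h
    linarith
  · obtain ⟨v, hv, hvK⟩ := Finset.not_subset.1 hsub
    obtain ⟨hvS, hvi⟩ := Finset.mem_filter.1 hv
    have hdeg : degIn G S v ≤ (S.filter fun u => ¬χ u = i).card :=
      Finset.card_le_card fun u hu => by
        rw [Finset.mem_filter] at hu ⊢
        exact ⟨hu.1, fun h => hvK (hK v u hu.2 (hvi.trans h.symm))⟩
    have hsplit := Finset.card_filter_add_card_filter_not (s := S) (fun u => χ u = i)
    have hdeg' : (degIn G S v : ℝ) ≤ S.card - S.card / (r + 1) := by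
      have h1 : (degIn G S v : ℝ) ≤ (S.filter fun u => ¬χ u = i).card := by exact_mod_cast hdeg
      have h2 : ((S.filter fun u => χ u = i).card : ℝ) + (S.filter fun u => ¬χ u = i).card
          = S.card := by exact_mod_cast hsplit
      linarith
    have hfull := (hS v hvS).trans hdeg'
    have hr1 : (r : ℝ) / (r + 1) = 1 - 1 / (r + 1) := by field_simp; ring
    have hr2 : 0 < 1 / ((r : ℝ) + 1) := by positivity
    have hmul : ε * (S.card - 1) ≤ 1 := by
      rw [hr1] at hfull
      have h3 : (S.card : ℝ) / (r + 1) = 1 / (r + 1) * S.card := by ring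
      rw [h3] at hfull
      linarith
    have h4 : (S.card : ℝ) - 1 ≤ 1 / ε := by
      rw [le_div_iff₀ hε]
      linarith
    have h5 : (0 : ℝ) ≤ (r + 1) * K.card := by positivity
    linarith

/-- The number of edges of a graph on a finite type between two given graphs can be prescribed. -/
theorem SimpleGraph.exists_card_edgeFinset_eq {V : Type*} [Fintype V] {T U : SimpleGraph V}
    (hTU : T ≤ U) {k : ℕ} (hT : T.edgeFinset.card ≤ k) (hU : k ≤ U.edgeFinset.card) :
    ∃ G : SimpleGraph V, T ≤ G ∧ G ≤ U ∧ G.edgeFinset.card = k := by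
  obtain ⟨E, hTE, hEU, hE⟩ := Finset.exists_subsuperset_card_eq
    (SimpleGraph.edgeFinset_mono hTU) hT hU
  have hset : (SimpleGraph.fromEdgeSet (E : Set (Sym2 V))).edgeSet = E := by
    rw [SimpleGraph.edgeSet_fromEdgeSet, sdiff_eq_left, Set.disjoint_left]
    intro e he
    exact U.not_isDiag_of_mem_edgeFinset (hEU he)
  refine ⟨SimpleGraph.fromEdgeSet E, ?_, ?_, ?_⟩
  · rw [← SimpleGraph.edgeSet_subset_edgeSet, hset, ← SimpleGraph.coe_edgeFinset]
    exact_mod_cast hTE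
  · rw [← SimpleGraph.edgeSet_subset_edgeSet, hset, ← SimpleGraph.coe_edgeFinset]
    exact_mod_cast hEU
  · rw [← hE]
    congr 1
    rw [← Finset.coe_inj, SimpleGraph.coe_edgeFinset, hset]

theorem SimpleGraph.two_mul_card_edgeFinset_turanGraph_mul (r n : ℕ) :
    2 * (SimpleGraph.turanGraph ((r + 1) * n) (r + 1)).edgeFinset.card = r * (r + 1) * n ^ 2 := by
  have h : (SimpleGraph.turanGraph ((r + 1) * n) (r + 1)).edgeFinset.card
      = (((r + 1) * n) ^ 2 - ((r + 1) * n % (r + 1)) ^ 2) * (r + 1 - 1) / (2 * (r + 1))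
        + ((r + 1) * n % (r + 1)).choose 2 := by
    rw [← SimpleGraph.card_edgeFinset_turanGraph]
  rw [h, Nat.mul_mod_right, Nat.choose_zero_succ, add_zero, zero_pow two_ne_zero,
    Nat.sub_zero, Nat.add_sub_cancel]
  obtain ⟨m, hm⟩ := (Nat.even_mul_succ_self r).two_dvd
  have hdiv : ((r + 1) * n) ^ 2 * r = 2 * (r + 1) * (m * n ^ 2) := by
    calc ((r + 1) * n) ^ 2 * r = (r * (r + 1)) * ((r + 1) * n ^ 2) := by ring
      _ = 2 * (r + 1) * (m * n ^ 2) := by rw [hm]; ring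
  rw [hdiv, Nat.mul_div_cancel_left _ (by positivity), hm]
  ring

/-- A complete balanced `(r + 1)`-partite graph to which edges inside a `t`-subset of one class
are added, with a prescribed number of edges. -/
theorem exists_graph_of_edge_bounds {r n t k : ℕ} (ht : t ≤ n)
    (hk : r * (r + 1) * n ^ 2 ≤ 2 * k)
    (hk' : 2 * k ≤ r * (r + 1) * n ^ 2 + 2 * t.choose 2) :
    ∃ (G : SimpleGraph (Fin ((r + 1) * n))) (K : Finset (Fin ((r + 1) * n))),
      G.edgeFinset.card = k ∧ K.card = t ∧
        ∀ u v, G.Adj u v → (u : ℕ) % (r + 1) = (v : ℕ) % (r + 1) → u ∈ K := by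
  let f : Fin t ↪ Fin ((r + 1) * n) :=
    ⟨fun i => ⟨(r + 1) * i, Nat.mul_lt_mul_of_pos_left (i.2.trans_le ht) r.succ_pos⟩,
      fun i j h => Fin.ext (Nat.eq_of_mul_eq_mul_left r.succ_pos (Fin.mk.inj h))⟩
  have hf (i : Fin t) : (f i : ℕ) = (r + 1) * i := rfl
  obtain ⟨T, hT⟩ : ∃ T, T = SimpleGraph.turanGraph ((r + 1) * n) (r + 1) := ⟨_, rfl⟩
  obtain ⟨Q, hQ⟩ : ∃ Q, Q = (⊤ : SimpleGraph (Fin t)).map f := ⟨_, rfl⟩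
  have hdisj : Disjoint T Q := by
    rw [disjoint_iff_inf_le]
    subst hT hQ
    rintro u v ⟨hT, -, i, j, -, rfl, rfl⟩
    exact hT (by rw [hf, hf, Nat.mul_mod_right, Nat.mul_mod_right])
  have hTcard : 2 * T.edgeFinset.card = r * (r + 1) * n ^ 2 := by
    rw [← SimpleGraph.two_mul_card_edgeFinset_turanGraph_mul r n]
    subst hT
    convert rfl
  have hQcard : Q.edgeFinset.card = t.choose 2 := by
    have h := SimpleGraph.card_edgeFinset_map f ⊤
    rw [SimpleGraph.card_edgeFinset_top_eq_card_choose_two, Fintype.card_fin] at h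
    rw [← h]
    subst hQ
    convert rfl
  have hTQ : (T ⊔ Q).edgeFinset.card = T.edgeFinset.card + Q.edgeFinset.card := by
    rw [SimpleGraph.edgeFinset_sup,
      Finset.card_union_of_disjoint (SimpleGraph.disjoint_edgeFinset.2 hdisj)]
  obtain ⟨G, -, hG, hcard⟩ := SimpleGraph.exists_card_edgeFinset_eq
    (T := T) (U := T ⊔ Q) (k := k) le_sup_left (by lia)
    ((by lia : k ≤ T.edgeFinset.card + Q.edgeFinset.card).trans_eq (by convert hTQ.symm))
  refine ⟨G, Finset.univ.map f, hcard, by simp, fun u v huv hmod => ?_⟩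
  subst hT hQ
  rcases hG huv with h | ⟨-, i, j, -, rfl, rfl⟩
  · exact absurd hmod h
  · simp

/-- for each `r ≥ 1` and real `c ≥ 1` there is `C > 0` such that for all
sufficiently large `n` for which `p = r/(r+1) + c ((r+1)n)^(-2/3)` makes `p * C((r+1)n, 2)`
a natural number, some graph on `(r+1)n` vertices with exactly `p * C((r+1)n,2)` edges has
no full subgraph on more than `C ((r+1)n)^(2/3)` vertices. -/
theorem stmt1 (r : ℕ) (hr : 1 ≤ r) (c : ℝ) (hc : 1 ≤ c) :
    ∃ C : ℝ, 0 < C ∧ ∃ N : ℕ, ∀ n : ℕ, N ≤ n →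
      (∃ k : ℕ, (k : ℝ) =
          ((r : ℝ)/(r + 1) + c * (((r + 1) * n : ℕ) : ℝ) ^ (-(2/3 : ℝ))) *
            ((((r + 1) * n).choose 2 : ℕ) : ℝ)) →
      ∃ G : SimpleGraph (Fin ((r + 1) * n)),
        (G.edgeFinset.card : ℝ) =
            ((r : ℝ)/(r + 1) + c * (((r + 1) * n : ℕ) : ℝ) ^ (-(2/3 : ℝ))) *
              ((((r + 1) * n).choose 2 : ℕ) : ℝ) ∧
        ∀ S : Finset (Fin ((r + 1) * n)),
          IsFull G ((r : ℝ)/(r + 1) + c * (((r + 1) * n : ℕ) : ℝ) ^ (-(2/3 : ℝ))) S →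
            (S.card : ℝ) ≤ C * (((r + 1) * n : ℕ) : ℝ) ^ ((2 : ℝ)/3) := by
  have hr0 : (1 : ℝ) ≤ r := by exact_mod_cast hr
  refine ⟨(r + 1) * (3 * c) + 2, by positivity, max 1 ⌈(3 * c * (r + 1)) ^ 3⌉₊, ?_⟩
  rintro n hn ⟨k, hk⟩
  set M : ℕ := (r + 1) * n with hM
  have hMr : (M : ℝ) = (r + 1) * n := by rw [hM]; push_cast; ring
  obtain ⟨hn1, hn2⟩ := max_le_iff.1 hn
  have hn1' : (1 : ℝ) ≤ n := by exact_mod_cast hn1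
  have hMbig : (3 * c * (r + 1)) ^ 3 ≤ (M : ℝ) := by
    have h := Nat.ceil_le.1 hn2
    rw [hMr]
    nlinarith
  have hM0 : (0 : ℝ) < M := by rw [hMr]; positivity
  set a : ℝ := (M : ℝ) ^ (1 / 3 : ℝ) with ha
  have ha0 : 0 < a := Real.rpow_pos_of_pos hM0 _
  have ha3 : a ^ 3 = M := by
    rw [ha, ← Real.rpow_natCast, ← Real.rpow_mul hM0.le]
    norm_num
  have ha2 : (M : ℝ) ^ ((2 : ℝ) / 3) = a ^ 2 := by
    rw [ha, ← Real.rpow_natCast, ← Real.rpow_mul hM0.le]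
    norm_num
  have ha2' : (M : ℝ) ^ (-(2 / 3 : ℝ)) = 1 / a ^ 2 := by
    rw [Real.rpow_neg hM0.le, ha2, one_div]
  have hab : 3 * c * (r + 1) ≤ a :=
    le_of_pow_le_pow_left₀ three_ne_zero ha0.le (hMbig.trans_eq ha3.symm)
  have ha6 : 6 ≤ a := by nlinarith
  rw [ha2'] at hk
  simp only [ha2', ha2]
  set t : ℕ := ⌈c * a ^ 2⌉₊ + 1 with ht
  have ht1 : c * a ^ 2 ≤ (t : ℝ) - 1 := by
    rw [ht]
    push_cast
    linarith [Nat.le_ceil (c * a ^ 2)]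
  have ht2 : (t : ℝ) ≤ 3 * c * a ^ 2 := by
    have h := (Nat.ceil_lt_add_one (show 0 ≤ c * a ^ 2 by positivity)).le
    rw [ht]
    push_cast
    nlinarith [mul_le_mul hc (show 1 ≤ a ^ 2 by nlinarith) zero_le_one (by linarith)]
  have htn : t ≤ n := by
    have h : ((r : ℝ) + 1) * t ≤ (r + 1) * n := by
      rw [← hMr, ← ha3]
      calc ((r : ℝ) + 1) * t ≤ (r + 1) * (3 * c * a ^ 2) := by gcongr
        _ = 3 * c * (r + 1) * a ^ 2 := by ring
        _ ≤ a * a ^ 2 := by gcongr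
        _ = a ^ 3 := by ring
    exact_mod_cast le_of_mul_le_mul_left h (by positivity)
  have hk2 : 2 * (k : ℝ) = r * (r + 1) * n ^ 2 + (c * (a ^ 4 - a) - r * n) := by
    have hnr : (n : ℝ) = a ^ 3 / (r + 1) := by
      rw [ha3, hMr, mul_div_cancel_left₀ _ (by positivity)]
    rw [hk, Nat.cast_choose_two, hnr, ← ha3]
    field_simp
    ring
  have hrn : (r : ℝ) * n ≤ a ^ 3 := by
    rw [ha3, hMr]
    linarith
  have hlow : r * (r + 1) * n ^ 2 ≤ 2 * k := by
    have h : a ^ 3 ≤ a ^ 4 - a := by nlinarith [pow_pos ha0 3, pow_pos ha0 2]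
    have h' : a ^ 4 - a ≤ c * (a ^ 4 - a) :=
      le_mul_of_one_le_left ((pow_pos ha0 3).le.trans h) hc
    have : (r : ℝ) * (r + 1) * n ^ 2 ≤ 2 * k := by linarith
    exact_mod_cast this
  have hupp : 2 * k ≤ r * (r + 1) * n ^ 2 + 2 * t.choose 2 := by
    have h1 : c * (a ^ 4 - a) - r * n ≤ c * a ^ 4 := by
      have : 0 ≤ c * a := by positivity
      have : (0 : ℝ) ≤ r * n := by positivity
      linarith
    have h2 : c * a ^ 4 ≤ (c * a ^ 2) * (c * a ^ 2) := by
      have : c * a ^ 4 ≤ c * (c * a ^ 4) := le_mul_of_one_le_left (by positivity) hc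
      linarith
    have h3 : (c * a ^ 2) * (c * a ^ 2) ≤ (t : ℝ) * (t - 1) := by
      have : 0 ≤ c * a ^ 2 := by positivity
      exact mul_le_mul (by linarith) ht1 this (by linarith)
    have : 2 * (k : ℝ) ≤ r * (r + 1) * n ^ 2 + 2 * (t.choose 2 : ℕ) := by
      rw [Nat.cast_choose_two]
      linarith
    exact_mod_cast this
  obtain ⟨G, K, hG, hKcard, hGK⟩ := exists_graph_of_edge_bounds htn hlow hupp
  refine ⟨G, ?_, fun S hS => ?_⟩
  · rw [← hk, hG]
  · have h := hS.card_le (by positivity) (fun v : Fin M => (v : ℕ) % (r + 1))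
      (fun v => Nat.mod_lt _ r.succ_pos) hGK
    rw [hKcard] at h
    have h1 : 1 / (c * (1 / a ^ 2)) ≤ a ^ 2 := by
      rw [mul_one_div, one_div_div]
      exact div_le_self (by positivity) hc
    have h2 : ((r : ℝ) + 1) * t ≤ (r + 1) * (3 * c * a ^ 2) := by gcongr
    nlinarith
end

section
/- There exists a constant c₁ > 0 such that for every n ≥ 2 and every graph G on n vertices, G contains a full subgraph or a co-full subgraph on at least c₁·n/log n vertices; that is, g(n) ≥ c₁·n/log n. -/
open scoped Classical

/-- `S` induces a `p`-co-full subgraph: every vertex of `S` has at most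
`p * (|S| - 1)` neighbours inside `S`. -/
def IsCoFull {V : Type*} (G : SimpleGraph V) (p : ℝ) (S : Finset V) : Prop :=
  ∀ v ∈ S, (degIn G S v : ℝ) ≤ p * ((S.card : ℝ) - 1)

/-- The density of `G`: `e(G) / C(n,2)`. -/
noncomputable def density {V : Type*} [Fintype V] (G : SimpleGraph V) : ℝ :=
  (G.edgeFinset.card : ℝ) / ((Fintype.card V).choose 2 : ℕ)

section CrossSum

variable {V : Type*}

/-- The sum of the entries of `M` with row in `A` and column in `B`. -/
def crossSum (M : V → V → ℝ) (A B : Finset V) : ℝ := ∑ i ∈ A, ∑ j ∈ B, M i j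

lemma crossSum_comm {M : V → V → ℝ} (hM : ∀ i j, M i j = M j i) (A B : Finset V) :
    crossSum M A B = crossSum M B A := by
  unfold crossSum
  rw [Finset.sum_comm]
  exact Finset.sum_congr rfl fun i _ => Finset.sum_congr rfl fun j _ => hM j i

lemma crossSum_neg (M : V → V → ℝ) (A B : Finset V) :
    crossSum (fun i j => -M i j) A B = -crossSum M A B := by
  simp [crossSum]

variable [DecidableEq V]

lemma crossSum_union_left (M : V → V → ℝ) {A B : Finset V} (h : Disjoint A B) (C : Finset V) :
    crossSum M (A ∪ B) C = crossSum M A C + crossSum M B C :=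
  Finset.sum_union h

lemma crossSum_union_right (M : V → V → ℝ) {A B : Finset V} (h : Disjoint A B) (C : Finset V) :
    crossSum M C (A ∪ B) = crossSum M C A + crossSum M C B := by
  unfold crossSum
  rw [← Finset.sum_add_distrib]
  exact Finset.sum_congr rfl fun i _ => Finset.sum_union h

lemma crossSum_union_self {M : V → V → ℝ} (hM : ∀ i j, M i j = M j i) {A B : Finset V}
    (h : Disjoint A B) :
    crossSum M (A ∪ B) (A ∪ B) = crossSum M A A + 2 * crossSum M A B + crossSum M B B := by
  rw [crossSum_union_left M h, crossSum_union_right M h, crossSum_union_right M h,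
    crossSum_comm hM B A]
  ring

lemma crossSum_biUnion {M : V → V → ℝ} {P R : Finset (Finset V)}
    (hP : (P : Set (Finset V)).PairwiseDisjoint id)
    (hR : (R : Set (Finset V)).PairwiseDisjoint id) :
    crossSum M (P.biUnion id) (R.biUnion id) = ∑ A ∈ P, ∑ B ∈ R, crossSum M A B := by
  unfold crossSum
  rw [Finset.sum_biUnion hP]
  refine Finset.sum_congr rfl fun A _ => ?_
  conv_rhs => rw [Finset.sum_comm]
  exact Finset.sum_congr rfl fun i _ => Finset.sum_biUnion hR

lemma crossSum_erase {M : V → V → ℝ} (hM : ∀ i j, M i j = M j i) (h0 : ∀ i, M i i = 0)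
    {S : Finset V} {v : V} (hv : v ∈ S) :
    crossSum M S S = crossSum M (S.erase v) (S.erase v) + 2 * ∑ j ∈ S, M v j := by
  have hd : Disjoint {v} (S.erase v) := by simp
  have hS : {v} ∪ S.erase v = S := by
    rw [← Finset.insert_eq, Finset.insert_erase hv]
  have h1 := crossSum_union_self hM hd
  rw [hS] at h1
  have h2 : crossSum M {v} {v} = 0 := by simp [crossSum, h0]
  have h3 : crossSum M {v} (S.erase v) = ∑ j ∈ S, M v j := by
    simp only [crossSum, Finset.sum_singleton]
    rw [← Finset.add_sum_erase S _ hv, h0, zero_add]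
  rw [h1, h2, h3]
  ring

/-- If every set of at least `m` elements has a negative row, then deleting such rows one by one
leads to a set of exactly `m` elements without decreasing the sum of all entries. -/
lemma exists_card_eq_crossSum_le {M : V → V → ℝ} (hM : ∀ i j, M i j = M j i)
    (h0 : ∀ i, M i i = 0) {m : ℕ}
    (H : ∀ S : Finset V, m ≤ S.card → ∃ v ∈ S, ∑ j ∈ S, M v j < 0)
    (S : Finset V) (hS : m ≤ S.card) :
    ∃ T ⊆ S, T.card = m ∧ crossSum M S S ≤ crossSum M T T := by
  induction S using Finset.strongInduction with
  | H S ih =>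
    rcases hS.eq_or_lt with h | h
    · exact ⟨S, subset_rfl, h.symm, le_rfl⟩
    · obtain ⟨v, hv, hlt⟩ := H S hS
      obtain ⟨T, hT, hc, hle⟩ := ih (S.erase v) (Finset.erase_ssubset hv)
        (by rw [Finset.card_erase_of_mem hv]; omega)
      refine ⟨T, hT.trans (Finset.erase_subset _ _), hc, ?_⟩
      rw [crossSum_erase hM h0 hv]
      linarith

/-- A symmetric matrix with zero diagonal has a cut carrying at least a quarter of its sum. -/
lemma exists_cut_ge {c : V → V → ℝ} (hc : ∀ i j, c i j = c j i) (h0 : ∀ i, c i i = 0)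
    (s : Finset V) : ∃ I ⊆ s, crossSum c s s ≤ 4 * crossSum c I (s \ I) := by
  induction s using Finset.induction_on with
  | empty => exact ⟨∅, subset_rfl, by simp [crossSum]⟩
  | insert a s ha ih =>
    obtain ⟨I, hI, hle⟩ := ih
    have haI : a ∉ I := fun h => ha (hI h)
    have hds : Disjoint {a} s := by simpa using ha
    have hdI : Disjoint {a} I := by simpa using haI
    have hdJ : Disjoint {a} (s \ I) := by simp [ha]
    have hIJ : I ∪ (s \ I) = s := Finset.union_sdiff_of_subset hI
    have htot : crossSum c (insert a s) (insert a s)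
        = 2 * crossSum c {a} s + crossSum c s s := by
      rw [Finset.insert_eq, crossSum_union_self hc hds]
      simp [crossSum, h0]
    have hsplit : crossSum c {a} s = crossSum c {a} I + crossSum c {a} (s \ I) := by
      conv_lhs => rw [← hIJ]
      exact crossSum_union_right c Finset.disjoint_sdiff _
    rcases le_total (crossSum c {a} I) (crossSum c {a} (s \ I)) with h | h
    · refine ⟨insert a I, Finset.insert_subset_insert a hI, ?_⟩
      have : insert a s \ insert a I = s \ I := by
        ext x; simp only [Finset.mem_sdiff, Finset.mem_insert]; grind
      rw [this, htot, Finset.insert_eq, crossSum_union_left c hdI]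
      linarith
    · refine ⟨I, hI.trans (Finset.subset_insert a s), ?_⟩
      have : insert a s \ I = {a} ∪ (s \ I) := by
        ext x; simp only [Finset.mem_sdiff, Finset.mem_insert, Finset.mem_union,
          Finset.mem_singleton]; grind
      rw [this, htot, crossSum_union_right c hdJ, crossSum_comm hc I {a}]
      linarith

lemma abs_crossSum_le_of_cut {c : V → V → ℝ} (hc : ∀ i j, c i j = c j i) (h0 : ∀ i, c i i = 0)
    {s : Finset V} {B : ℝ} (h : ∀ I ⊆ s, |crossSum c I (s \ I)| ≤ B) :
    |crossSum c s s| ≤ 4 * B := by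
  obtain ⟨I, hI, h1⟩ := exists_cut_ge hc h0 s
  obtain ⟨J, hJ, h2⟩ := exists_cut_ge (c := fun i j => -c i j) (fun i j => by rw [hc])
    (fun i => by simp [h0]) s
  rw [crossSum_neg, crossSum_neg] at h2
  have h3 := abs_le.1 (h I hI)
  have h4 := abs_le.1 (h J hJ)
  exact abs_le.2 ⟨by linarith, by linarith⟩

/-- Every subset of `U` missing at most `k` elements of `U` has entry sum at most `D` in absolute
value. -/
def SumBounded (M : V → V → ℝ) (k : ℕ) (U : Finset V) (D : ℝ) : Prop :=
  ∀ S ⊆ U, U.card ≤ S.card + k → |crossSum M S S| ≤ D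

lemma SumBounded.abs_crossSum_le {M : V → V → ℝ} (hM : ∀ i j, M i j = M j i) {k : ℕ}
    {U : Finset V} {D : ℝ} (h : SumBounded M k U D) {A B : Finset V} (hA : A ⊆ U) (hB : B ⊆ U)
    (hAB : Disjoint A B) (hk : A.card + B.card ≤ k) : |crossSum M A B| ≤ 2 * D := by
  set W := U \ (A ∪ B) with hW
  have hWA : Disjoint W A := Finset.sdiff_disjoint.mono_right Finset.subset_union_left
  have hWB : Disjoint W B := Finset.sdiff_disjoint.mono_right Finset.subset_union_right
  have hWAB : Disjoint (W ∪ A) B := Finset.disjoint_union_left.2 ⟨hWB, hAB⟩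
  have hWU : W ⊆ U := Finset.sdiff_subset
  have hU : W ∪ A ∪ B = U := by
    rw [Finset.union_assoc]
    exact Finset.sdiff_union_of_subset (Finset.union_subset hA hB)
  have hcard : W.card + A.card + B.card = U.card := by
    rw [← hU, Finset.card_union_of_disjoint hWAB, Finset.card_union_of_disjoint hWA]
  have e1 := crossSum_union_self hM hWAB
  rw [hU, crossSum_union_self hM hWA, crossSum_union_left M hWA] at e1
  have e2 := crossSum_union_self hM hWA
  have e3 := crossSum_union_self hM hWB
  have b1 := abs_le.1 (h U subset_rfl (by omega))
  have b2 := abs_le.1 (h W hWU (by omega))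
  have b3 := abs_le.1 (h (W ∪ A) (Finset.union_subset hWU hA)
    (by rw [Finset.card_union_of_disjoint hWA]; omega))
  have b4 := abs_le.1 (h (W ∪ B) (Finset.union_subset hWU hB)
    (by rw [Finset.card_union_of_disjoint hWB]; omega))
  exact abs_le.2 ⟨by linarith, by linarith⟩

lemma SumBounded.abs_sum_crossSum_le {M : V → V → ℝ} (hM : ∀ i j, M i j = M j i)
    (h0 : ∀ i, M i i = 0) {k : ℕ} {U : Finset V} {D : ℝ} (h : SumBounded M k U D)
    {P : Finset (Finset V)} (hP : (P : Set (Finset V)).PairwiseDisjoint id)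
    (hPU : ∀ A ∈ P, A ⊆ U) (hk : (P.biUnion id).card ≤ k) :
    |∑ A ∈ P, crossSum M A A| ≤ 16 * D := by
  have hsub : P.biUnion id ⊆ U := Finset.biUnion_subset.2 hPU
  have hin : |crossSum M (P.biUnion id) (P.biUnion id)| ≤ 4 * (2 * D) := by
    refine abs_crossSum_le_of_cut hM h0 fun I hI => ?_
    refine h.abs_crossSum_le hM (hI.trans hsub) (Finset.sdiff_subset.trans hsub)
      Finset.disjoint_sdiff ?_
    rw [add_comm, Finset.card_sdiff_add_card_eq_card hI]
    exact hk
  let c : Finset V → Finset V → ℝ := fun A B => if A = B then 0 else crossSum M A B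
  have hoff : |crossSum c P P| ≤ 4 * (2 * D) := by
    refine abs_crossSum_le_of_cut (c := c) (fun A B => ?_) (fun A => by simp [c]) fun I hI => ?_
    · simp only [c, eq_comm (a := A), crossSum_comm hM A]
    · have hJ : P \ I ⊆ P := Finset.sdiff_subset
      have e : crossSum c I (P \ I) = crossSum M (I.biUnion id) ((P \ I).biUnion id) := by
        rw [crossSum_biUnion (hP.subset (by exact_mod_cast hI))
          (hP.subset (by exact_mod_cast hJ))]
        refine Finset.sum_congr rfl fun A hA => Finset.sum_congr rfl fun B hB => ?_
        have : A ≠ B := fun hh => (Finset.mem_sdiff.1 hB).2 (hh ▸ hA)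
        simp [c, this]
      have hd : Disjoint (I.biUnion id) ((P \ I).biUnion id) := by
        simp only [Finset.disjoint_biUnion_left, Finset.disjoint_biUnion_right]
        intro B hB A hA
        exact hP (hI hA) (hJ hB) fun hh => (Finset.mem_sdiff.1 hB).2 (hh ▸ hA)
      rw [e]
      refine h.abs_crossSum_le hM (Finset.biUnion_subset.2 fun A hA => hPU A (hI hA))
        (Finset.biUnion_subset.2 fun A hA => hPU A (hJ hA)) hd ?_
      rw [← Finset.card_union_of_disjoint hd]
      refine (Finset.card_le_card ?_).trans hk
      exact Finset.union_subset (Finset.biUnion_subset_biUnion_of_subset_left _ hI)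
        (Finset.biUnion_subset_biUnion_of_subset_left _ hJ)
  have htot : crossSum M (P.biUnion id) (P.biUnion id)
      = ∑ A ∈ P, crossSum M A A + crossSum c P P := by
    rw [crossSum_biUnion hP hP]
    unfold crossSum
    rw [← Finset.sum_add_distrib]
    refine Finset.sum_congr rfl fun A hA => ?_
    rw [← Finset.add_sum_erase P _ hA, ← Finset.add_sum_erase P (c A) hA]
    have : ∑ B ∈ P.erase A, c A B = ∑ B ∈ P.erase A, crossSum M A B :=
      Finset.sum_congr rfl fun B hB => by simp [c, (Finset.ne_of_mem_erase hB).symm]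
    rw [this]
    simp [c, crossSum]
  have b1 := abs_le.1 hin
  have b2 := abs_le.1 hoff
  exact abs_le.2 ⟨by linarith, by linarith⟩

lemma SumBounded.sum_abs_crossSum_le {M : V → V → ℝ} (hM : ∀ i j, M i j = M j i)
    (h0 : ∀ i, M i i = 0) {k : ℕ} {U : Finset V} {D : ℝ} (h : SumBounded M k U D)
    {P : Finset (Finset V)} (hP : (P : Set (Finset V)).PairwiseDisjoint id)
    (hPU : ∀ A ∈ P, A ⊆ U) (hk : (P.biUnion id).card ≤ k) :
    ∑ A ∈ P, |crossSum M A A| ≤ 32 * D := by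
  have key : ∀ R ⊆ P, |∑ A ∈ R, crossSum M A A| ≤ 16 * D := fun R hR =>
    h.abs_sum_crossSum_le hM h0 (hP.subset (by exact_mod_cast hR)) (fun A hA => hPU A (hR hA))
      ((Finset.card_le_card (Finset.biUnion_subset_biUnion_of_subset_left _ hR)).trans hk)
  rw [← Finset.sum_filter_add_sum_filter_not P fun A => 0 ≤ crossSum M A A]
  have e1 : ∑ A ∈ P with 0 ≤ crossSum M A A, |crossSum M A A|
      = ∑ A ∈ P with 0 ≤ crossSum M A A, crossSum M A A :=
    Finset.sum_congr rfl fun A hA => abs_of_nonneg (Finset.mem_filter.1 hA).2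
  have e2 : ∑ A ∈ P with ¬ 0 ≤ crossSum M A A, |crossSum M A A|
      = -∑ A ∈ P with ¬ 0 ≤ crossSum M A A, crossSum M A A := by
    rw [← Finset.sum_neg_distrib]
    exact Finset.sum_congr rfl fun A hA =>
      abs_of_neg (not_le.1 (Finset.mem_filter.1 hA).2)
  have b1 := abs_le.1 (key _ (Finset.filter_subset (fun A => 0 ≤ crossSum M A A) P))
  have b2 := abs_le.1 (key _ (Finset.filter_subset (fun A => ¬ 0 ≤ crossSum M A A) P))
  rw [e1, e2]
  linarith

lemma SumBounded.exists_half {M : V → V → ℝ} (hM : ∀ i j, M i j = M j i)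
    (h0 : ∀ i, M i i = 0) {m : ℕ} (hm : 0 < m)
    (hneg : ∀ S : Finset V, m ≤ S.card → ∃ v ∈ S, ∑ j ∈ S, M v j < 0)
    (hpos : ∀ S : Finset V, m ≤ S.card → ∃ v ∈ S, 0 < ∑ j ∈ S, M v j)
    {U : Finset V} {D : ℝ} (hD : 0 < D) (h : SumBounded M (65 * m) U D)
    (hU : 131 * m ≤ U.card) :
    ∃ W ⊆ U, U.card ≤ W.card + 65 * m ∧ SumBounded M (65 * m) W (D / 2) := by
  by_contra! hcon
  have hfam : ∀ i ≤ 65, ∃ P : Finset (Finset V), P.card = i ∧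
      (P : Set (Finset V)).PairwiseDisjoint id ∧
      ∀ A ∈ P, A ⊆ U ∧ A.card = m ∧ D / 2 < |crossSum M A A| := by
    intro i
    induction i with
    | zero => exact fun _ => ⟨∅, by simp⟩
    | succ i ih =>
      intro hi
      obtain ⟨P, hPc, hPd, hP⟩ := ih (by omega)
      have hcard : (P.biUnion id).card ≤ i * m := by
        rw [← hPc]
        exact Finset.card_biUnion_le_card_mul _ _ _ fun A hA => (hP A hA).2.1.le
      have him : i * m ≤ 65 * m := Nat.mul_le_mul_right m (by omega)
      have hsub : P.biUnion id ⊆ U := Finset.biUnion_subset.2 fun A hA => (hP A hA).1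
      have hW := Finset.card_sdiff_add_card_eq_card hsub
      have hnb := hcon (U \ P.biUnion id) Finset.sdiff_subset (by omega)
      unfold SumBounded at hnb
      push Not at hnb
      obtain ⟨S, hSW, hSc, hS⟩ := hnb
      have hSm : m ≤ S.card := by omega
      obtain ⟨T, hTS, hTc, hT⟩ : ∃ T ⊆ S, T.card = m ∧ D / 2 < |crossSum M T T| := by
        rcases lt_abs.1 hS with hS | hS
        · obtain ⟨T, h1, h2, h3⟩ := exists_card_eq_crossSum_le hM h0 hneg S hSm
          exact ⟨T, h1, h2, lt_abs.2 (Or.inl (hS.trans_le h3))⟩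
        · obtain ⟨T, h1, h2, h3⟩ := exists_card_eq_crossSum_le (M := fun i j => -M i j)
            (fun i j => by rw [hM]) (fun i => by simp [h0])
            (fun S hS => by simpa using hpos S hS) S hSm
          rw [crossSum_neg, crossSum_neg] at h3
          exact ⟨T, h1, h2, lt_abs.2 (Or.inr (hS.trans_le h3))⟩
      have hTW : T ⊆ U \ P.biUnion id := hTS.trans hSW
      have hdisj : ∀ A ∈ P, Disjoint T A := fun A hA =>
        (Finset.disjoint_sdiff.symm.mono_left hTW).mono_right (Finset.subset_biUnion_of_mem id hA)
      have hTP : T ∉ P := fun hh => by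
        have := hdisj T hh
        rw [disjoint_self, Finset.bot_eq_empty] at this
        rw [this, Finset.card_empty] at hTc
        omega
      refine ⟨insert T P, by rw [Finset.card_insert_of_notMem hTP, hPc], ?_, ?_⟩
      · rw [Finset.coe_insert]
        exact hPd.insert fun A hA _ => hdisj A hA
      · intro A hA
        rcases Finset.mem_insert.1 hA with rfl | hA
        · exact ⟨hTW.trans Finset.sdiff_subset, hTc, hT⟩
        · exact hP A hA
  obtain ⟨P, hPc, hPd, hP⟩ := hfam 65 le_rfl
  have hcard : (P.biUnion id).card ≤ 65 * m := by
    rw [← hPc]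
    exact Finset.card_biUnion_le_card_mul _ _ _ fun A hA => (hP A hA).2.1.le
  have hle := h.sum_abs_crossSum_le hM h0 hPd (fun A hA => (hP A hA).1) hcard
  have hge := Finset.card_nsmul_le_sum P (fun A => |crossSum M A A|) (D / 2)
    fun A hA => (hP A hA).2.2.le
  rw [hPc, nsmul_eq_mul] at hge
  push_cast at hge
  linarith

lemma SumBounded.exists_div_two_pow {M : V → V → ℝ} (hM : ∀ i j, M i j = M j i)
    (h0 : ∀ i, M i i = 0) {m : ℕ} (hm : 0 < m)
    (hneg : ∀ S : Finset V, m ≤ S.card → ∃ v ∈ S, ∑ j ∈ S, M v j < 0)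
    (hpos : ∀ S : Finset V, m ≤ S.card → ∃ v ∈ S, 0 < ∑ j ∈ S, M v j)
    {U : Finset V} {D : ℝ} (hD : 0 < D) (h : SumBounded M (65 * m) U D) (r : ℕ)
    (hU : 65 * m * r + 131 * m ≤ U.card) :
    ∃ W ⊆ U, U.card ≤ W.card + 65 * m * r ∧ SumBounded M (65 * m) W (D / 2 ^ r) := by
  induction r with
  | zero => exact ⟨U, subset_rfl, by omega, by simpa using h⟩
  | succ r ih =>
    rw [Nat.mul_succ] at hU
    obtain ⟨W, hWU, hWc, hW⟩ := ih (by omega)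
    obtain ⟨X, hXW, hXc, hX⟩ := hW.exists_half hM h0 hm hneg hpos (by positivity) (by omega)
    refine ⟨X, hXW.trans hWU, by rw [Nat.mul_succ]; omega, ?_⟩
    rwa [pow_succ, ← div_div]

/-- A symmetric matrix whose entries lie in `[-1, 1]` and are integer multiples of `1 / N` has a
large set of indices inside which all rows are nonnegative, or all rows are nonpositive. -/
lemma exists_large_row_sum_sign [Fintype V] {M : V → V → ℝ} (hM : ∀ i j, M i j = M j i)
    (h0 : ∀ i, M i i = 0) (h1 : ∀ i j, |M i j| ≤ 1) {N : ℕ}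
    (hN0 : 0 < N) (hN : ∀ i j, ∃ z : ℤ, N * M i j = z) {m r : ℕ} (hm : 0 < m)
    (hr : (Fintype.card V : ℝ) ^ 2 * N < 2 ^ r)
    (hV : 65 * m * r + 131 * m ≤ Fintype.card V) :
    ∃ S : Finset V, m ≤ S.card ∧
      ((∀ v ∈ S, 0 ≤ ∑ j ∈ S, M v j) ∨ ∀ v ∈ S, ∑ j ∈ S, M v j ≤ 0) := by
  by_contra! hcon
  have hneg : ∀ S : Finset V, m ≤ S.card → ∃ v ∈ S, ∑ j ∈ S, M v j < 0 :=
    fun S hS => (hcon S hS).1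
  have hpos : ∀ S : Finset V, m ≤ S.card → ∃ v ∈ S, 0 < ∑ j ∈ S, M v j :=
    fun S hS => (hcon S hS).2
  have hcV : 0 < Fintype.card V := by omega
  have hb : SumBounded M (65 * m) Finset.univ ((Fintype.card V : ℝ) ^ 2) := by
    intro S _ _
    have hrow : ∀ i ∈ S, |∑ j ∈ S, M i j| ≤ Fintype.card V := fun i _ => by
      refine (Finset.abs_sum_le_sum_abs _ _).trans ((Finset.sum_le_card_nsmul _ _ 1
        fun j _ => h1 i j).trans ?_)
      rw [nsmul_eq_mul, mul_one]
      exact_mod_cast Finset.card_le_univ S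
    refine (Finset.abs_sum_le_sum_abs _ _).trans ((Finset.sum_le_card_nsmul _ _ _ hrow).trans ?_)
    rw [nsmul_eq_mul, sq]
    gcongr
    exact Finset.card_le_univ S
  obtain ⟨W, -, hWc, hW⟩ := hb.exists_div_two_pow hM h0 hm hneg hpos (by positivity) r
    (by rwa [Finset.card_univ])
  rw [Finset.card_univ] at hWc
  obtain ⟨v, hv, hlt⟩ := hneg W (by omega)
  have e := crossSum_erase hM h0 hv
  have b1 := abs_le.1 (hW W subset_rfl (by omega))
  have b2 := abs_le.1 (hW (W.erase v) (Finset.erase_subset _ _)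
    (by rw [Finset.card_erase_of_mem hv]; omega))
  choose z hz using hN
  have hzs : (N : ℝ) * ∑ j ∈ W, M v j = ((∑ j ∈ W, z v j : ℤ) : ℝ) := by
    rw [Finset.mul_sum]
    push_cast
    exact Finset.sum_congr rfl fun j _ => hz v j
  have hsmall : (Fintype.card V : ℝ) ^ 2 / 2 ^ r * N < 1 := by
    rw [div_mul_eq_mul_div, div_lt_one (by positivity)]
    exact hr
  have hN0' : (0 : ℝ) < N := by exact_mod_cast hN0
  have hzneg : (∑ j ∈ W, z v j : ℤ) ≤ -1 := by
    have : ((∑ j ∈ W, z v j : ℤ) : ℝ) < 0 := by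
      rw [← hzs]; exact mul_neg_of_pos_of_neg hN0' hlt
    have : (∑ j ∈ W, z v j : ℤ) < 0 := by exact_mod_cast this
    omega
  have hzneg' : ((∑ j ∈ W, z v j : ℤ) : ℝ) ≤ -1 := by exact_mod_cast hzneg
  rw [← hzs] at hzneg'
  nlinarith

end CrossSum

/-- there is `c₁ > 0` such that every graph on `n ≥ 2` vertices contains a
full or a co-full subgraph on at least `c₁ n / log n` vertices. -/
theorem stmt8 :
    ∃ c₁ : ℝ, 0 < c₁ ∧ ∀ n : ℕ, 2 ≤ n → ∀ G : SimpleGraph (Fin n),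
      ∃ S : Finset (Fin n),
        (IsFull G (density G) S ∨ IsCoFull G (density G) S) ∧
        c₁ * n / Real.log n ≤ (S.card : ℝ) := by
  refine ⟨1 / 2080, by norm_num, fun n hn G => ?_⟩
  set p := density G with hp
  have hn0 : (0 : ℝ) < n := by positivity
  have hlog2 : (0.69 : ℝ) ≤ Real.log 2 := by linarith [Real.log_two_gt_d9]
  have hL2 : Real.log 2 ≤ Real.log n := Real.log_le_log (by norm_num) (by exact_mod_cast hn)
  have hL : 0 < Real.log n := by linarith
  rcases le_or_gt (1 / 2080 * (n : ℝ) / Real.log n) 1 with hsmall | hbig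
  · refine ⟨{⟨0, by omega⟩}, Or.inl fun v _ => by simp, by simpa using hsmall⟩
  set N := n.choose 2 with hNdef
  have hN0 : 0 < N := Nat.choose_pos hn
  have hN0' : (0 : ℝ) < N := by exact_mod_cast hN0
  have hpe : p = (G.edgeFinset.card : ℝ) / N := by simp [hp, density, hNdef]
  have hp0 : 0 ≤ p := by rw [hpe]; positivity
  have hp1 : p ≤ 1 := by
    rw [hpe, div_le_one hN0']
    have := G.card_edgeFinset_le_card_choose_two
    rw [Fintype.card_fin] at this
    exact_mod_cast this
  let M : Fin n → Fin n → ℝ := fun i j => if i = j then 0 else (if G.Adj i j then 1 else 0) - p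
  have hrow : ∀ S : Finset (Fin n), ∀ v ∈ S,
      ∑ j ∈ S, M v j = degIn G S v - p * ((S.card : ℝ) - 1) := by
    intro S v hv
    rw [← Finset.add_sum_erase S _ hv]
    have e1 : ∑ j ∈ S.erase v, M v j = ∑ j ∈ S.erase v, ((if G.Adj v j then (1 : ℝ) else 0) - p) :=
      Finset.sum_congr rfl fun j hj => by simp [M, (Finset.ne_of_mem_erase hj).symm]
    have e2 : ∑ j ∈ S.erase v, (if G.Adj v j then (1 : ℝ) else 0) = degIn G S v := by
      have := Finset.add_sum_erase S (fun j => if G.Adj v j then (1 : ℝ) else 0) hv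
      simp only [SimpleGraph.irrefl, if_false, zero_add] at this
      rw [this, Finset.sum_boole, degIn]
    rw [e1, Finset.sum_sub_distrib, e2, Finset.sum_const, Finset.card_erase_of_mem hv,
      nsmul_eq_mul, Nat.cast_sub (Finset.card_pos.2 ⟨v, hv⟩)]
    simp only [M, if_true]
    push_cast
    ring
  set m := ⌈1 / 2080 * (n : ℝ) / Real.log n⌉₊ with hmdef
  have hm0 : 0 < m := Nat.ceil_pos.2 (by linarith)
  have hm2 : (m : ℝ) ≤ 2 * (1 / 2080 * (n : ℝ) / Real.log n) := by
    have := Nat.ceil_lt_add_one (a := 1 / 2080 * (n : ℝ) / Real.log n) (by linarith)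
    linarith
  set r := 4 * (Nat.log 2 n + 1) with hrdef
  have hpow : (n : ℝ) ^ 4 < 2 ^ r := by
    have h : n < 2 ^ (Nat.log 2 n + 1) := Nat.lt_pow_succ_log_self (by norm_num) n
    have h' : n ^ 4 < (2 ^ (Nat.log 2 n + 1)) ^ 4 := Nat.pow_lt_pow_left h (by norm_num)
    rw [← pow_mul, mul_comm _ 4] at h'
    exact_mod_cast h'
  have hNle : (N : ℝ) ≤ (n : ℝ) ^ 2 := by
    exact_mod_cast Nat.choose_le_pow n 2
  have hlogn : (Nat.log 2 n : ℝ) * Real.log 2 ≤ Real.log n := by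
    rw [← Real.log_pow]
    refine Real.log_le_log (by positivity) ?_
    exact_mod_cast Nat.pow_log_le_self 2 (by omega)
  have hrL : (r : ℝ) + 3 ≤ 16 * Real.log n := by
    have h1 : (Nat.log 2 n : ℝ) * 0.69 ≤ Real.log n :=
      (mul_le_mul_of_nonneg_left hlog2 (by positivity)).trans hlogn
    have h2 : (r : ℝ) = 4 * ((Nat.log 2 n : ℝ) + 1) := by rw [hrdef]; push_cast; ring
    rw [h2]
    linarith
  have hcard : 65 * m * r + 131 * m ≤ n := by
    have h1 : (65 : ℝ) * m * (r + 3) ≤ n := by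
      calc (65 : ℝ) * m * (r + 3)
          ≤ 65 * (2 * (1 / 2080 * (n : ℝ) / Real.log n)) * (16 * Real.log n) := by gcongr
        _ = n := by field_simp; norm_num
    have h2 : 65 * m * (r + 3) ≤ n := by exact_mod_cast h1
    calc 65 * m * r + 131 * m ≤ 65 * m * (r + 3) := by ring_nf; omega
      _ ≤ n := h2
  obtain ⟨S, hS, hsign⟩ := exists_large_row_sum_sign (M := M) (N := N) (m := m) (r := r)
    (fun i j => by simp only [M, eq_comm (a := i), G.adj_comm i])
    (fun i => by simp [M])
    (fun i j => by
      simp only [M]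
      split_ifs <;> rw [abs_le] <;> constructor <;> linarith)
    hN0
    (fun i j => by
      have hNp : (N : ℝ) * p = G.edgeFinset.card := by rw [hpe]; field_simp
      simp only [M]
      split_ifs
      · exact ⟨0, by simp⟩
      · exact ⟨N - G.edgeFinset.card, by push_cast; rw [mul_sub, hNp, mul_one]⟩
      · exact ⟨-G.edgeFinset.card, by push_cast; rw [mul_sub, hNp]; ring⟩)
    hm0
    (by
      rw [Fintype.card_fin]
      calc (n : ℝ) ^ 2 * N ≤ (n : ℝ) ^ 2 * (n : ℝ) ^ 2 := by gcongr
        _ = (n : ℝ) ^ 4 := by ring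
        _ < 2 ^ r := hpow)
    (by rwa [Fintype.card_fin])
  refine ⟨S, ?_, (Nat.le_ceil _).trans (by exact_mod_cast hS)⟩
  rcases hsign with h | h
  · exact Or.inl fun v hv => by linarith [h v hv, hrow S v hv]
  · exact Or.inr fun v hv => by linarith [h v hv, hrow S v hv]
end
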